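/- arXiv:math-ph/0601006 — 3 statements merged into one kernel-verified Lean document; each statement's English description precedes it below -/
import Mathlib

section
/- Let Ω, ∂Ω, σ, n, q be as in the context, with Ω contained in the closed ball of radius R > 0 centered at the origin. Let E ≥ 1 and 0 ≤ β. Let φ, ψ : ℝ^d → ℝ be C² on a neighborhood of the closure of Ω, satisfying −Δφ = E_φ·φ and −Δψ = E_ψ·ψ on Ω with |E_φ − E| ≤ E^β and |E_ψ − E| ≤ E^β, with ∫_Ω φ(x)² dx = 1, ∫_Ω ψ(x)² dx = 1 and ∫_Ω φ(x)·ψ(x) dx = 0, and both satisfying the mixed homogeneous boundary conditions: there are a subset Γ_D ⊆ ∂Ω and a function γ : ∂Ω → ℝ such that φ and ψ vanish on Γ_D and γ(x)·φ(x) + ⟨n(x),∇φ(x)⟩ = 0 and γ(x)·ψ(x) + ⟨n(x),∇ψ(x)⟩ = 0 for all x ∈ ∂Ω ∖ Γ_D. Then |q(φ,ψ; E_φ+E_ψ)|/(2E) ≤ (R²/2)·E^{2β−1}. -/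
open MeasureTheory
open scoped RealInnerProductSpace Classical

noncomputable section

/-- The Euclidean Laplacian: the sum of the second partial derivatives. -/
def lap {d : ℕ} (u : EuclideanSpace ℝ (Fin d) → ℝ) (x : EuclideanSpace ℝ (Fin d)) : ℝ :=
  ∑ i, fderiv ℝ (fun y => fderiv ℝ u y (EuclideanSpace.single i (1:ℝ))) x
    (EuclideanSpace.single i (1:ℝ))

/-- The divergence: the sum of the partial derivatives of the components. -/
def divg {d : ℕ} (F : EuclideanSpace ℝ (Fin d) → EuclideanSpace ℝ (Fin d))
    (x : EuclideanSpace ℝ (Fin d)) : ℝ :=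
  ∑ i, fderiv ℝ (fun y => ⟪F y, EuclideanSpace.single i (1:ℝ)⟫) x
    (EuclideanSpace.single i (1:ℝ))

/-- The boundary bilinear form `q(u, v; 𝓔)`. -/
def qform (d : ℕ) (Ω : Set (EuclideanSpace ℝ (Fin d)))
    (n : EuclideanSpace ℝ (Fin d) → EuclideanSpace ℝ (Fin d))
    (u v : EuclideanSpace ℝ (Fin d) → ℝ) (cE : ℝ) : ℝ :=
  ∫ x in frontier Ω,
    (((d : ℝ) - 2) / 2 * (⟪n x, gradient u x⟫ * v x + ⟪n x, gradient v x⟫ * u x)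
      + ⟪x, n x⟫ * (cE / 2 * u x * v x - ⟪gradient u x, gradient v x⟫)
      + ⟪x, gradient u x⟫ * ⟪n x, gradient v x⟫
      + ⟪x, gradient v x⟫ * ⟪n x, gradient u x⟫) ∂(μH[(d:ℝ) - 1])

theorem aux_inner_grad {d : ℕ} (u : EuclideanSpace ℝ (Fin d) → ℝ) (x w : EuclideanSpace ℝ (Fin d)) :
    fderiv ℝ u x w = ⟪gradient u x, w⟫ := by
  simp [gradient]

/-- The trace of an endomorphism. -/
def auxTr {d : ℕ} (L : EuclideanSpace ℝ (Fin d) →L[ℝ] EuclideanSpace ℝ (Fin d)) : ℝ :=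
  ∑ i, ⟪L (EuclideanSpace.single i (1:ℝ)), EuclideanSpace.single i (1:ℝ)⟫

theorem aux_divg {d : ℕ} {F : EuclideanSpace ℝ (Fin d) → EuclideanSpace ℝ (Fin d)}
    {L : EuclideanSpace ℝ (Fin d) →L[ℝ] EuclideanSpace ℝ (Fin d)}
    {x : EuclideanSpace ℝ (Fin d)} (h : HasFDerivAt F L x) : divg F x = auxTr L := by
  unfold divg auxTr
  refine Finset.sum_congr rfl fun i _ => ?_
  have h2 := h.inner ℝ (hasFDerivAt_const (EuclideanSpace.single i (1:ℝ)) x)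
  rw [h2.fderiv]
  simp [fderivInnerCLM_apply]

theorem aux_lap {d : ℕ} {u : EuclideanSpace ℝ (Fin d) → ℝ}
    {L : EuclideanSpace ℝ (Fin d) →L[ℝ] EuclideanSpace ℝ (Fin d)}
    {x : EuclideanSpace ℝ (Fin d)} (h : HasFDerivAt (gradient u) L x) : lap u x = auxTr L := by
  rw [← aux_divg h]
  unfold lap divg
  simp only [aux_inner_grad]

theorem auxTr_add {d : ℕ} (L M : EuclideanSpace ℝ (Fin d) →L[ℝ] EuclideanSpace ℝ (Fin d)) :
    auxTr (L + M) = auxTr L + auxTr M := by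
  simp only [auxTr, ContinuousLinearMap.add_apply, inner_add_left, Finset.sum_add_distrib]

theorem auxTr_smul {d : ℕ} (c : ℝ) (L : EuclideanSpace ℝ (Fin d) →L[ℝ] EuclideanSpace ℝ (Fin d)) :
    auxTr (c • L) = c * auxTr L := by
  simp only [auxTr, ContinuousLinearMap.smul_apply, real_inner_smul_left, Finset.mul_sum]

theorem auxTr_id {d : ℕ} : auxTr (ContinuousLinearMap.id ℝ (EuclideanSpace ℝ (Fin d))) = d := by
  simp [auxTr]

theorem auxTr_smulRight {d : ℕ} (f : EuclideanSpace ℝ (Fin d) →L[ℝ] ℝ)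
    (V : EuclideanSpace ℝ (Fin d)) : auxTr (f.smulRight V) = f V := by
  have hV := (EuclideanSpace.basisFun (Fin d) ℝ).sum_repr V
  conv_rhs => rw [← hV]
  rw [map_sum]
  unfold auxTr
  refine Finset.sum_congr rfl fun i _ => ?_
  simp [real_inner_smul_left, mul_comm]
  left
  simp [EuclideanSpace.inner_single_right]

theorem aux_gradC1 {d : ℕ} {u : EuclideanSpace ℝ (Fin d) → ℝ} {U : Set (EuclideanSpace ℝ (Fin d))}
    (hU : IsOpen U) (hu : ContDiffOn ℝ 2 u U) : ContDiffOn ℝ 1 (gradient u) U := by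
  have h1 : ContDiffOn ℝ 1 (fderiv ℝ u) U := hu.fderiv_of_isOpen hU (by norm_num)
  exact ((InnerProductSpace.toDual ℝ (EuclideanSpace ℝ (Fin d))).symm.toContinuousLinearEquiv.toContinuousLinearMap.contDiff
    |>.comp_contDiffOn h1)

theorem aux_symm {d : ℕ} {u : EuclideanSpace ℝ (Fin d) → ℝ} {x : EuclideanSpace ℝ (Fin d)}
    (hu : ContDiffAt ℝ 2 u x)
    {L : EuclideanSpace ℝ (Fin d) →L[ℝ] EuclideanSpace ℝ (Fin d)}
    (h : HasFDerivAt (gradient u) L x) (v w : EuclideanSpace ℝ (Fin d)) :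
    ⟪L v, w⟫ = ⟪L w, v⟫ := by
  have hs : IsSymmSndFDerivAt ℝ u x := hu.isSymmSndFDerivAt (by simp)
  have key : ∀ v w, fderiv ℝ (fderiv ℝ u) x v w = ⟪L v, w⟫ := by
    intro v w
    have hd1 : DifferentiableAt ℝ (fderiv ℝ u) x :=
      (hu.fderiv_right (m := 1) (by norm_num)).differentiableAt (by norm_num)
    have e1 := (hd1.hasFDerivAt.clm_apply (hasFDerivAt_const w x)).fderiv
    have e2 := (h.inner ℝ (hasFDerivAt_const w x)).fderiv
    have e3 : (fun y => fderiv ℝ u y w) = fun y => ⟪gradient u y, w⟫ := by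
      funext y; exact aux_inner_grad u y w
    rw [e3, e2] at e1
    have := congrArg (fun T => T v) e1
    simpa [fderivInnerCLM_apply] using this.symm
  rw [← key, ← key]
  exact hs v w

/-- The combined vector field. -/
def auxG {d : ℕ} (u v : EuclideanSpace ℝ (Fin d) → ℝ) (a b : ℝ)
    (x : EuclideanSpace ℝ (Fin d)) : EuclideanSpace ℝ (Fin d) :=
  (((d:ℝ) - 2) / 2 * u x + ⟪x, gradient u x⟫ + (a - b) / 4 * (⟪x, x⟫ * u x)) • gradient v x
  + (((d:ℝ) - 2) / 2 * v x + ⟪x, gradient v x⟫ - (a - b) / 4 * (⟪x, x⟫ * v x)) • gradient u x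
  + ((a + b) / 2 * (u x * v x) - ⟪gradient u x, gradient v x⟫) • x

theorem auxG_contDiffOn {d : ℕ} {u v : EuclideanSpace ℝ (Fin d) → ℝ} (a b : ℝ)
    {U : Set (EuclideanSpace ℝ (Fin d))} (hU : IsOpen U) (hu : ContDiffOn ℝ 2 u U)
    (hv : ContDiffOn ℝ 2 v U) : ContDiffOn ℝ 1 (auxG u v a b) U := by
  have gu := aux_gradC1 hU hu
  have gv := aux_gradC1 hU hv
  have hu1 : ContDiffOn ℝ 1 u U := hu.of_le (by norm_num)
  have hv1 : ContDiffOn ℝ 1 v U := hv.of_le (by norm_num)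
  have hid : ContDiffOn ℝ 1 (fun x : EuclideanSpace ℝ (Fin d) => x) U := contDiffOn_id
  unfold auxG
  refine ContDiffOn.add (ContDiffOn.add ?_ ?_) ?_
  · exact (((contDiffOn_const.mul hu1).add (hid.inner ℝ gu)).add
      (contDiffOn_const.mul ((hid.inner ℝ hid).mul hu1))).smul gv
  · exact (((contDiffOn_const.mul hv1).add (hid.inner ℝ gv)).sub
      (contDiffOn_const.mul ((hid.inner ℝ hid).mul hv1))).smul gu
  · exact ((contDiffOn_const.mul (hu1.mul hv1)).sub (gu.inner ℝ gv)).smul hid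

theorem auxG_divg {d : ℕ} {u v : EuclideanSpace ℝ (Fin d) → ℝ} (a b : ℝ)
    {x : EuclideanSpace ℝ (Fin d)} (hu : ContDiffAt ℝ 2 u x) (hv : ContDiffAt ℝ 2 v x)
    (hgu : DifferentiableAt ℝ (gradient u) x) (hgv : DifferentiableAt ℝ (gradient v) x)
    (hlu : -lap u x = a * u x) (hlv : -lap v x = b * v x) :
    divg (auxG u v a b) x = (a + b) * (u x * v x) + (a - b) ^ 2 / 4 * (‖x‖ ^ 2 * (u x * v x)) := by
  obtain ⟨A, hA⟩ := hgu
  obtain ⟨B, hB⟩ := hgv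
  have sA := aux_symm hu hA
  have sB := aux_symm hv hB
  rw [aux_lap hA] at hlu
  rw [aux_lap hB] at hlv
  have du := (hu.differentiableAt (by norm_num)).hasFDerivAt
  have dv := (hv.differentiableAt (by norm_num)).hasFDerivAt
  have di := hasFDerivAt_id (𝕜 := ℝ) x
  have h1 := (((du.const_mul (((d:ℝ) - 2) / 2)).add (di.inner ℝ hA)).add
      (((di.inner ℝ di).mul du).const_mul ((a - b) / 4))).smul hB
  have h2 := (((dv.const_mul (((d:ℝ) - 2) / 2)).add (di.inner ℝ hB)).sub
      (((di.inner ℝ di).mul dv).const_mul ((a - b) / 4))).smul hA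
  have h3 := (((du.mul dv).const_mul ((a + b) / 2)).sub (hA.inner ℝ hB)).smul di
  have h := (h1.add h2).add h3
  have e := aux_divg (F := auxG u v a b) h
  rw [e]
  simp only [auxTr_add, auxTr_smul, auxTr_smulRight, auxTr_id]
  simp only [ContinuousLinearMap.add_apply, ContinuousLinearMap.sub_apply,
    ContinuousLinearMap.smul_apply, ContinuousLinearMap.comp_apply,
    ContinuousLinearMap.prod_apply, fderivInnerCLM_apply, ContinuousLinearMap.id_apply, id_eq,
    aux_inner_grad, smul_eq_mul, Pi.add_apply, Pi.sub_apply, Pi.mul_apply]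
  have hlu' : auxTr A = - (a * u x) := by linarith
  have hlv' : auxTr B = - (b * v x) := by linarith
  rw [hlu', hlv', ← real_inner_self_eq_norm_sq]
  have t1 : ⟪x, A (gradient v x)⟫ = ⟪A x, gradient v x⟫ := by
    rw [real_inner_comm]; exact sA _ _
  have t2 : ⟪x, B (gradient u x)⟫ = ⟪gradient u x, B x⟫ := by
    rw [real_inner_comm, sB, real_inner_comm]
  rw [t1, t2, real_inner_comm (gradient u x) (gradient v x), real_inner_comm x (gradient v x),
    real_inner_comm x (gradient u x)]
  ring

theorem quasi_orthogonality_window_bound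
    (d : ℕ) (hd : 2 ≤ d) (Ω : Set (EuclideanSpace ℝ (Fin d)))
    (hΩo : IsOpen Ω) (hΩb : Bornology.IsBounded Ω)
    (n : EuclideanSpace ℝ (Fin d) → EuclideanSpace ℝ (Fin d))
    (R : ℝ) (hR : 0 < R) (hΩR : Ω ⊆ Metric.closedBall 0 R)
    (En : ℝ) (hEn : 1 ≤ En) (β : ℝ) (hβ : 0 ≤ β)
    (hGG : ∀ F : EuclideanSpace ℝ (Fin d) → EuclideanSpace ℝ (Fin d),
      (∃ U, IsOpen U ∧ closure Ω ⊆ U ∧ ContDiffOn ℝ 1 F U) →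
      (∫ x in Ω, divg F x) = ∫ x in frontier Ω, ⟪F x, n x⟫ ∂(μH[(d:ℝ) - 1]))
    (φ ψ : EuclideanSpace ℝ (Fin d) → ℝ) (Eφ Eψ : ℝ)
    (hφr : ∃ U, IsOpen U ∧ closure Ω ⊆ U ∧ ContDiffOn ℝ 2 φ U) (hψr : ∃ U, IsOpen U ∧ closure Ω ⊆ U ∧ ContDiffOn ℝ 2 ψ U)
    (hHφ : ∀ x ∈ Ω, -lap φ x = Eφ * φ x) (hHψ : ∀ x ∈ Ω, -lap ψ x = Eψ * ψ x)
    (hEφ : |Eφ - En| ≤ En ^ β) (hEψ : |Eψ - En| ≤ En ^ β)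
    (hφnorm : (∫ x in Ω, (φ x) ^ 2) = 1)
    (hψnorm : (∫ x in Ω, (ψ x) ^ 2) = 1)
    (horth : (∫ x in Ω, φ x * ψ x) = 0)
    (hbc : ∃ ΓD ⊆ frontier Ω, ∃ γ : EuclideanSpace ℝ (Fin d) → ℝ,
      (∀ x ∈ ΓD, φ x = 0 ∧ ψ x = 0) ∧
      ∀ x ∈ frontier Ω \ ΓD,
        γ x * φ x + ⟪n x, gradient φ x⟫ = 0 ∧
        γ x * ψ x + ⟪n x, gradient ψ x⟫ = 0)
    :
    |qform d Ω n φ ψ (Eφ + Eψ)| / (2 * En) ≤ R ^ 2 / 2 * En ^ (2 * β - 1) := by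
  obtain ⟨U₁, hU₁, hc₁, hφ₁⟩ := hφr
  obtain ⟨U₂, hU₂, hc₂, hψ₂⟩ := hψr
  have hU : IsOpen (U₁ ∩ U₂) := hU₁.inter hU₂
  have hc : closure Ω ⊆ U₁ ∩ U₂ := Set.subset_inter hc₁ hc₂
  have hφ : ContDiffOn ℝ 2 φ (U₁ ∩ U₂) := hφ₁.mono Set.inter_subset_left
  have hψ : ContDiffOn ℝ 2 ψ (U₁ ∩ U₂) := hψ₂.mono Set.inter_subset_right
  have hK : IsCompact (closure Ω) := hΩb.isCompact_closure
  have hcφ : ContinuousOn φ (closure Ω) := hφ.continuousOn.mono hc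
  have hcψ : ContinuousOn ψ (closure Ω) := hψ.continuousOn.mono hc
  have hint : ∀ f : EuclideanSpace ℝ (Fin d) → ℝ, ContinuousOn f (closure Ω) →
      IntegrableOn f Ω volume := fun f hf =>
    (hf.integrableOn_compact hK).mono_set subset_closure
  -- Gauss-Green applied to the combined field
  have hG := hGG (auxG φ ψ Eφ Eψ) ⟨_, hU, hc, auxG_contDiffOn Eφ Eψ hU hφ hψ⟩
  have hq : (∫ x in frontier Ω, ⟪auxG φ ψ Eφ Eψ x, n x⟫ ∂(μH[(d:ℝ) - 1]))
      = qform d Ω n φ ψ (Eφ + Eψ) := by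
    unfold qform
    refine setIntegral_congr_fun isClosed_frontier.measurableSet fun x hx => ?_
    obtain ⟨ΓD, hΓ, γ, hD, hN⟩ := hbc
    have hw : ψ x * ⟪n x, gradient φ x⟫ = φ x * ⟪n x, gradient ψ x⟫ := by
      by_cases hxD : x ∈ ΓD
      · rw [(hD x hxD).1, (hD x hxD).2]; ring
      · obtain ⟨p, r⟩ := hN x ⟨hx, hxD⟩
        linear_combination ψ x * p - φ x * r
    simp only [auxG, inner_add_left, real_inner_smul_left]
    rw [real_inner_comm (n x) (gradient φ x), real_inner_comm (n x) (gradient ψ x)]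
    linear_combination (-(Eφ - Eψ) / 4 * ⟪x, x⟫) * hw
  have hI : (∫ x in Ω, divg (auxG φ ψ Eφ Eψ) x)
      = (Eφ - Eψ) ^ 2 / 4 * ∫ x in Ω, ‖x‖ ^ 2 * (φ x * ψ x) := by
    have e1 : (∫ x in Ω, divg (auxG φ ψ Eφ Eψ) x) = ∫ x in Ω, ((Eφ + Eψ) * (φ x * ψ x)
        + (Eφ - Eψ) ^ 2 / 4 * (‖x‖ ^ 2 * (φ x * ψ x))) := by
      refine setIntegral_congr_fun hΩo.measurableSet fun x hx => ?_
      have hxU := hU.mem_nhds (hc (subset_closure hx))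
      exact auxG_divg Eφ Eψ (hφ.contDiffAt hxU) (hψ.contDiffAt hxU)
        (((aux_gradC1 hU hφ).contDiffAt hxU).differentiableAt (by norm_num))
        (((aux_gradC1 hU hψ).contDiffAt hxU).differentiableAt (by norm_num))
        (hHφ x hx) (hHψ x hx)
    have i1 := hint (fun x => (Eφ + Eψ) * (φ x * ψ x)) (by fun_prop)
    have i2 := hint (fun x => (Eφ - Eψ) ^ 2 / 4 * (‖x‖ ^ 2 * (φ x * ψ x))) (by fun_prop)
    rw [e1, integral_add i1 i2, integral_const_mul, integral_const_mul, horth]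
    ring
  have hB : |∫ x in Ω, ‖x‖ ^ 2 * (φ x * ψ x)| ≤ R ^ 2 := by
    have i1 := hint (fun x => φ x ^ 2) (by fun_prop)
    have i2 := hint (fun x => ψ x ^ 2) (by fun_prop)
    have hb : ‖∫ x in Ω, ‖x‖ ^ 2 * (φ x * ψ x)‖
        ≤ ∫ x in Ω, R ^ 2 / 2 * (φ x ^ 2 + ψ x ^ 2) := by
      refine norm_integral_le_of_norm_le ((i1.add i2).const_mul _) ?_
      filter_upwards [ae_restrict_mem hΩo.measurableSet] with x hx
      have hxR : ‖x‖ ≤ R := by simpa using hΩR hx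
      have h1 : ‖x‖ ^ 2 ≤ R ^ 2 := by gcongr
      have h2 : |φ x * ψ x| ≤ (φ x ^ 2 + ψ x ^ 2) / 2 := by
        rw [abs_le]
        constructor <;> nlinarith [sq_nonneg (φ x + ψ x), sq_nonneg (φ x - ψ x)]
      rw [norm_mul, Real.norm_eq_abs, Real.norm_eq_abs, abs_of_nonneg (sq_nonneg ‖x‖)]
      calc ‖x‖ ^ 2 * |φ x * ψ x| ≤ R ^ 2 * ((φ x ^ 2 + ψ x ^ 2) / 2) := by gcongr
        _ = _ := by ring
    rw [integral_const_mul, integral_add i1 i2, hφnorm, hψnorm] at hb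
    rw [Real.norm_eq_abs] at hb
    linarith
  have hE0 : 0 < En := by linarith
  have hdiff : (Eφ - Eψ) ^ 2 ≤ (2 * En ^ β) ^ 2 := by
    apply sq_le_sq'
    · linarith [(abs_le.1 hEφ).1, (abs_le.1 hEψ).2]
    · linarith [(abs_le.1 hEφ).2, (abs_le.1 hEψ).1]
  have hfin : |qform d Ω n φ ψ (Eφ + Eψ)| ≤ (En ^ β) ^ 2 * R ^ 2 := by
    rw [← hq, ← hG, hI, abs_mul, abs_of_nonneg (by positivity : 0 ≤ (Eφ - Eψ) ^ 2 / 4)]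
    calc _ ≤ ((2 * En ^ β) ^ 2 / 4) * R ^ 2 := by gcongr
      _ = _ := by ring
  have hpow : En ^ (2 * β - 1) = (En ^ β) ^ 2 / En := by
    rw [Real.rpow_sub hE0, Real.rpow_one, mul_comm 2 β, Real.rpow_mul hE0.le]
    norm_num
  rw [hpow]
  calc _ ≤ (En ^ β) ^ 2 * R ^ 2 / (2 * En) := by gcongr
    _ = _ := by field_simp
end
end

section
/- Let Ω, ∂Ω, σ, n be as in the context, let c ∈ ℝ^d, and define the translated boundary form q_c(u,v;𝓔) := ∫_{∂Ω} [ ((d−2)/2)(⟨n(x),∇u(x)⟩v(x) + ⟨n(x),∇v(x)⟩u(x)) + ⟨x−c,n(x)⟩((𝓔/2)u(x)v(x) − ⟨∇u(x),∇v(x)⟩) + ⟨x−c,∇u(x)⟩⟨n(x),∇v(x)⟩ + ⟨x−c,∇v(x)⟩⟨n(x),∇u(x)⟩ ] dσ(x). Let φ, ψ : ℝ^d → ℝ be C² on a neighborhood of the closure of Ω, satisfying −Δφ = E_φ·φ and −Δψ = E_ψ·ψ on Ω, with ∫_Ω φ(x)² dx = 1, ∫_Ω ψ(x)² dx = 1 and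 ∫_Ω φ(x)·ψ(x) dx = 0, and both satisfying the mixed homogeneous boundary conditions (there are Γ_D ⊆ ∂Ω and γ : ∂Ω → ℝ with φ, ψ vanishing on Γ_D and γ·φ + ⟨n,∇φ⟩ = 0, γ·ψ + ⟨n,∇ψ⟩ = 0 on ∂Ω ∖ Γ_D). Then: (i) q_c(φ,φ; 2E_φ) = 2E_φ, independently of the choice of c; and (ii) if Ω is contained in the closed ball of radius R_c centered at c, then |q_c(φ,ψ; E_φ+E_ψ)| ≤ (R_c²/4)·(E_φ − E_ψ)². -/
open MeasureTheory
open scoped RealInnerProductSpace Classical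

noncomputable section

/-- The translated boundary bilinear form `q_c(u, v; 𝓔)` with origin `c`. -/
def qformc (d : ℕ) (Ω : Set (EuclideanSpace ℝ (Fin d)))
    (n : EuclideanSpace ℝ (Fin d) → EuclideanSpace ℝ (Fin d))
    (c : EuclideanSpace ℝ (Fin d))
    (u v : EuclideanSpace ℝ (Fin d) → ℝ) (cE : ℝ) : ℝ :=
  ∫ x in frontier Ω,
    (((d : ℝ) - 2) / 2 * (⟪n x, gradient u x⟫ * v x + ⟪n x, gradient v x⟫ * u x)
      + ⟪x - c, n x⟫ * (cE / 2 * u x * v x - ⟪gradient u x, gradient v x⟫)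
      + ⟪x - c, gradient u x⟫ * ⟪n x, gradient v x⟫
      + ⟪x - c, gradient v x⟫ * ⟪n x, gradient u x⟫) ∂(μH[(d:ℝ) - 1])


section Helpers

variable {d : ℕ}


theorem aux_divg_eq {F : EuclideanSpace ℝ (Fin d) → EuclideanSpace ℝ (Fin d)}
    {F' : EuclideanSpace ℝ (Fin d) →L[ℝ] EuclideanSpace ℝ (Fin d)} {x : EuclideanSpace ℝ (Fin d)}
    (h : HasFDerivAt F F' x) :
    divg F x = ∑ i, ⟪F' (EuclideanSpace.single i (1:ℝ)), EuclideanSpace.single i (1:ℝ)⟫ := by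
  unfold divg
  refine Finset.sum_congr rfl fun i _ => ?_
  have := (h.inner ℝ (hasFDerivAt_const (EuclideanSpace.single i (1:ℝ)) x)).fderiv
  rw [this]
  simp

theorem aux_sum_apply (L : EuclideanSpace ℝ (Fin d) →L[ℝ] ℝ) (w : EuclideanSpace ℝ (Fin d)) :
    ∑ i, L (EuclideanSpace.single i (1:ℝ)) * ⟪w, EuclideanSpace.single i (1:ℝ)⟫ = L w := by
  have hw : w = ∑ i, ⟪w, EuclideanSpace.single i (1:ℝ)⟫ • EuclideanSpace.single i (1:ℝ) := by
    have := (EuclideanSpace.basisFun (Fin d) ℝ).sum_repr w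
    conv_lhs => rw [← this]
    refine Finset.sum_congr rfl fun i _ => ?_
    simp [EuclideanSpace.inner_single_right]
  conv_rhs => rw [hw]
  simp [mul_comm]

theorem aux_divg_smul {f : EuclideanSpace ℝ (Fin d) → ℝ}
    {F : EuclideanSpace ℝ (Fin d) → EuclideanSpace ℝ (Fin d)} {x : EuclideanSpace ℝ (Fin d)}
    (hf : DifferentiableAt ℝ f x) (hF : DifferentiableAt ℝ F x) :
    divg (fun y => f y • F y) x = f x * divg F x + fderiv ℝ f x (F x) := by
  rw [show divg (fun y => f y • F y) x = _ from aux_divg_eq (hf.hasFDerivAt.smul hF.hasFDerivAt), aux_divg_eq hF.hasFDerivAt,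
    ← aux_sum_apply (fderiv ℝ f x) (F x), Finset.mul_sum, ← Finset.sum_add_distrib]
  refine Finset.sum_congr rfl fun i _ => ?_
  simp [inner_add_left, inner_smul_left]

theorem aux_divg_add {F G : EuclideanSpace ℝ (Fin d) → EuclideanSpace ℝ (Fin d)}
    {x : EuclideanSpace ℝ (Fin d)}
    (hF : DifferentiableAt ℝ F x) (hG : DifferentiableAt ℝ G x) :
    divg (fun y => F y + G y) x = divg F x + divg G x := by
  rw [show divg (fun y => F y + G y) x = _ from aux_divg_eq (hF.hasFDerivAt.add hG.hasFDerivAt), aux_divg_eq hF.hasFDerivAt,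
    aux_divg_eq hG.hasFDerivAt, ← Finset.sum_add_distrib]
  refine Finset.sum_congr rfl fun i _ => ?_
  simp [inner_add_left]

theorem aux_divg_sub_const (c x : EuclideanSpace ℝ (Fin d)) :
    divg (fun y => y - c) x = d := by
  rw [show divg (fun y => y - c) x = _ from aux_divg_eq ((hasFDerivAt_id x).sub_const c)]
  simp

theorem aux_divg_grad (u : EuclideanSpace ℝ (Fin d) → ℝ) (x : EuclideanSpace ℝ (Fin d)) :
    divg (gradient u) x = lap u x := by
  unfold divg lap gradient
  simp

theorem aux_fderiv_inner_grad (u : EuclideanSpace ℝ (Fin d) → ℝ) (x w : EuclideanSpace ℝ (Fin d)) :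
    fderiv ℝ u x w = ⟪w, gradient u x⟫ := by
  unfold gradient
  rw [real_inner_comm]
  simp

theorem aux_contDiffAt_grad {u : EuclideanSpace ℝ (Fin d) → ℝ} {x : EuclideanSpace ℝ (Fin d)}
    (h : ContDiffAt ℝ 2 u x) : ContDiffAt ℝ 1 (gradient u) x := by
  unfold gradient
  have h1 : ContDiffAt ℝ 1 (fderiv ℝ u) x := h.fderiv_right (by norm_num)
  exact (InnerProductSpace.toDual ℝ (EuclideanSpace ℝ (Fin d))).symm.toContinuousLinearEquiv.contDiff.contDiffAt.comp x h1

theorem aux_grad_symm {u : EuclideanSpace ℝ (Fin d) → ℝ} {x : EuclideanSpace ℝ (Fin d)}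
    (h : ContDiffAt ℝ 2 u x) (w z : EuclideanSpace ℝ (Fin d)) :
    ⟪fderiv ℝ (gradient u) x w, z⟫ = ⟪w, fderiv ℝ (gradient u) x z⟫ := by
  have h1 : DifferentiableAt ℝ (fderiv ℝ u) x :=
    ContDiffAt.differentiableAt (n := 1) (h.fderiv_right (by norm_num)) (by norm_num)
  have h2 := (aux_contDiffAt_grad h).differentiableAt (by norm_num)
  have key : ∀ w z : (EuclideanSpace ℝ (Fin d)), ⟪fderiv ℝ (gradient u) x w, z⟫ = fderiv ℝ (fderiv ℝ u) x w z := by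
    intro w z
    have e : (fun y => fderiv ℝ u y z) = fun y => ⟪gradient u y, z⟫ := by
      funext y
      rw [aux_fderiv_inner_grad, real_inner_comm]
    have a := (h1.hasFDerivAt.clm_apply (hasFDerivAt_const z x)).fderiv
    have b := (h2.hasFDerivAt.inner ℝ (hasFDerivAt_const z x)).fderiv
    rw [e, b] at a
    have := congrArg (fun L => L w) a
    simpa using this
  rw [key, real_inner_comm, key]
  exact (h.isSymmSndFDerivAt (by simp)) w z

/-- The vector field whose flux is the form `q_c`. -/
def auxF (c : EuclideanSpace ℝ (Fin d)) (u v : EuclideanSpace ℝ (Fin d) → ℝ) (cE : ℝ) :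
    EuclideanSpace ℝ (Fin d) → EuclideanSpace ℝ (Fin d) := fun y =>
  (((((d : ℝ) - 2) / 2 * v y + ⟪y - c, gradient v y⟫) • gradient u y
    + (((d : ℝ) - 2) / 2 * u y + ⟪y - c, gradient u y⟫) • gradient v y)
    + (cE / 2 * (u y * v y) - ⟪gradient u y, gradient v y⟫) • (y - c))

theorem aux_contDiffAt_F {c x : EuclideanSpace ℝ (Fin d)} {u v : EuclideanSpace ℝ (Fin d) → ℝ}
    {cE : ℝ} (hu : ContDiffAt ℝ 2 u x) (hv : ContDiffAt ℝ 2 v x) :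
    ContDiffAt ℝ 1 (auxF c u v cE) x := by
  have hu1 : ContDiffAt ℝ 1 u x := hu.of_le (by norm_num)
  have hv1 : ContDiffAt ℝ 1 v x := hv.of_le (by norm_num)
  have gu := aux_contDiffAt_grad hu
  have gv := aux_contDiffAt_grad hv
  have hX : ContDiffAt ℝ 1 (fun y : (EuclideanSpace ℝ (Fin d)) => y - c) x := contDiffAt_id.sub contDiffAt_const
  unfold auxF
  have k1 := (contDiffAt_const (c := ((d : ℝ) - 2) / 2)).mul hv1 |>.add (hX.inner ℝ gv)
  have k2 := (contDiffAt_const (c := ((d : ℝ) - 2) / 2)).mul hu1 |>.add (hX.inner ℝ gu)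
  have k3 := (contDiffAt_const (c := cE / 2)).mul (hu1.mul hv1) |>.sub (gu.inner ℝ gv)
  exact ((k1.smul gu).add (k2.smul gv)).add (k3.smul hX)

theorem aux_divg_F {c x : EuclideanSpace ℝ (Fin d)} {u v : EuclideanSpace ℝ (Fin d) → ℝ}
    {Eu Ev : ℝ} (hu : ContDiffAt ℝ 2 u x) (hv : ContDiffAt ℝ 2 v x)
    (lu : -lap u x = Eu * u x) (lv : -lap v x = Ev * v x) :
    divg (auxF c u v (Eu + Ev)) x = (Eu + Ev) * (u x * v x)
      + (Ev - Eu) / 2 * (u x * ⟪x - c, gradient v x⟫ - v x * ⟪x - c, gradient u x⟫) := by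
  have hu1 : DifferentiableAt ℝ u x := hu.differentiableAt (by norm_num)
  have hv1 : DifferentiableAt ℝ v x := hv.differentiableAt (by norm_num)
  have gu := (aux_contDiffAt_grad hu).differentiableAt (by norm_num)
  have gv := (aux_contDiffAt_grad hv).differentiableAt (by norm_num)
  have hX : HasFDerivAt (fun y : (EuclideanSpace ℝ (Fin d)) => y - c) (ContinuousLinearMap.id ℝ (EuclideanSpace ℝ (Fin d))) x :=
    (hasFDerivAt_id x).sub_const c
  have k1 := (hv1.hasFDerivAt.const_mul (((d : ℝ) - 2) / 2)).add (hX.inner ℝ gv.hasFDerivAt)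
  have k2 := (hu1.hasFDerivAt.const_mul (((d : ℝ) - 2) / 2)).add (hX.inner ℝ gu.hasFDerivAt)
  have k3 := ((hu1.hasFDerivAt.mul hv1.hasFDerivAt).const_mul ((Eu + Ev) / 2)).sub
    (gu.hasFDerivAt.inner ℝ gv.hasFDerivAt)
  have s1 := aux_divg_smul k1.differentiableAt gu
  have s2 := aux_divg_smul k2.differentiableAt gv
  have s3 := aux_divg_smul k3.differentiableAt hX.differentiableAt
  rw [k1.fderiv, aux_divg_grad] at s1
  rw [k2.fderiv, aux_divg_grad] at s2
  rw [k3.fderiv, aux_divg_sub_const] at s3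
  have a1 := aux_divg_add (k1.differentiableAt.smul gu) (k2.differentiableAt.smul gv)
  have a2 := aux_divg_add ((k1.differentiableAt.smul gu).add (k2.differentiableAt.smul gv))
    (k3.differentiableAt.smul hX.differentiableAt)
  have t : divg (auxF c u v (Eu + Ev)) x = _ := a2.trans (congrArg₂ (· + ·)
    (a1.trans (congrArg₂ (· + ·) s1 s2)) s3)
  rw [t]
  have lu' : lap u x = -(Eu * u x) := by linarith
  have lv' : lap v x = -(Ev * v x) := by linarith
  have y1 := aux_grad_symm hu (x - c) (gradient v x)
  have y2 := aux_grad_symm hv (x - c) (gradient u x)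
  have y3 := real_inner_comm (gradient u x) (gradient v x)
  have y4 := real_inner_comm (gradient u x) (fderiv ℝ (gradient v) x (x - c))
  simp only [Pi.mul_apply, Pi.add_apply, Pi.sub_apply, add_apply, sub_apply,
    smul_apply, ContinuousLinearMap.comp_apply, fderivInnerCLM_apply,
    ContinuousLinearMap.prod_apply, ContinuousLinearMap.id_apply, smul_eq_mul,
    aux_fderiv_inner_grad, lu', lv']
  linear_combination (-1 : ℝ) * y1 - y2 + y4 + (d : ℝ) / 2 * y3

end Helpers

theorem translated_quasi_orthogonality
    (d : ℕ) (hd : 2 ≤ d) (Ω : Set (EuclideanSpace ℝ (Fin d)))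
    (hΩo : IsOpen Ω) (hΩb : Bornology.IsBounded Ω)
    (n : EuclideanSpace ℝ (Fin d) → EuclideanSpace ℝ (Fin d))
    (c : EuclideanSpace ℝ (Fin d))
    (hGG : ∀ F : EuclideanSpace ℝ (Fin d) → EuclideanSpace ℝ (Fin d),
      (∃ U, IsOpen U ∧ closure Ω ⊆ U ∧ ContDiffOn ℝ 1 F U) →
      (∫ x in Ω, divg F x) = ∫ x in frontier Ω, ⟪F x, n x⟫ ∂(μH[(d:ℝ) - 1]))
    (φ ψ : EuclideanSpace ℝ (Fin d) → ℝ) (Eφ Eψ : ℝ)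
    (hφr : ∃ U, IsOpen U ∧ closure Ω ⊆ U ∧ ContDiffOn ℝ 2 φ U) (hψr : ∃ U, IsOpen U ∧ closure Ω ⊆ U ∧ ContDiffOn ℝ 2 ψ U)
    (hHφ : ∀ x ∈ Ω, -lap φ x = Eφ * φ x) (hHψ : ∀ x ∈ Ω, -lap ψ x = Eψ * ψ x)
    (hφnorm : (∫ x in Ω, (φ x) ^ 2) = 1)
    (hψnorm : (∫ x in Ω, (ψ x) ^ 2) = 1)
    (horth : (∫ x in Ω, φ x * ψ x) = 0)
    (hbc : ∃ ΓD ⊆ frontier Ω, ∃ γ : EuclideanSpace ℝ (Fin d) → ℝ,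
      (∀ x ∈ ΓD, φ x = 0 ∧ ψ x = 0) ∧
      ∀ x ∈ frontier Ω \ ΓD,
        γ x * φ x + ⟪n x, gradient φ x⟫ = 0 ∧
        γ x * ψ x + ⟪n x, gradient ψ x⟫ = 0)
    :
    qformc d Ω n c φ φ (2 * Eφ) = 2 * Eφ ∧
      ∀ Rc : ℝ, Ω ⊆ Metric.closedBall c Rc →
        |qformc d Ω n c φ ψ (Eφ + Eψ)| ≤ Rc ^ 2 / 4 * (Eφ - Eψ) ^ 2 := by
  obtain ⟨U, hUo, hU, hφU⟩ := hφr
  obtain ⟨V, hVo, hV, hψV⟩ := hψr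
  have cφ : ∀ x ∈ U, ContDiffAt ℝ 2 φ x := fun x hx => hφU.contDiffAt (hUo.mem_nhds hx)
  have cψ : ∀ x ∈ V, ContDiffAt ℝ 2 ψ x := fun x hx => hψV.contDiffAt (hVo.mem_nhds hx)
  have hUΩ : Ω ⊆ U := subset_closure.trans hU
  have hVΩ : Ω ⊆ V := subset_closure.trans hV
  have hK : IsCompact (closure Ω) := hΩb.isCompact_closure
  have hint : ∀ f : EuclideanSpace ℝ (Fin d) → ℝ, (∀ x ∈ closure Ω, ContinuousAt f x) →
      IntegrableOn f Ω := fun f hf =>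
    (ContinuousOn.integrableOn_compact hK
      fun x hx => (hf x hx).continuousWithinAt).mono_set subset_closure
  have q_eq : ∀ (u v : EuclideanSpace ℝ (Fin d) → ℝ) (cE : ℝ) (W : Set (EuclideanSpace ℝ (Fin d))),
      IsOpen W → closure Ω ⊆ W → (∀ x ∈ W, ContDiffAt ℝ 2 u x) → (∀ x ∈ W, ContDiffAt ℝ 2 v x) →
      qformc d Ω n c u v cE = ∫ x in Ω, divg (auxF c u v cE) x := by
    intro u v cE W hWo hW hu hv
    rw [hGG (auxF c u v cE) ⟨W, hWo, hW, fun x hx =>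
      (aux_contDiffAt_F (hu x hx) (hv x hx)).contDiffWithinAt⟩]
    unfold qformc
    congr 1
    funext x
    simp only [auxF, inner_add_left, real_inner_smul_left]
    rw [real_inner_comm (gradient u x) (n x), real_inner_comm (gradient v x) (n x)]
    ring
  refine ⟨?_, ?_⟩
  · rw [q_eq φ φ _ U hUo hU cφ cφ]
    have : ∀ x ∈ Ω, divg (auxF c φ φ (2 * Eφ)) x = 2 * Eφ * (φ x) ^ 2 := by
      intro x hx
      rw [two_mul, aux_divg_F (cφ x (hUΩ hx)) (cφ x (hUΩ hx)) (hHφ x hx) (hHφ x hx)]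
      ring
    rw [setIntegral_congr_fun hΩo.measurableSet this, integral_const_mul, hφnorm, mul_one]
  · intro Rc hRc
    have dφ : ∀ x ∈ closure Ω, ContinuousAt φ x := fun x hx => (cφ x (hU hx)).continuousAt
    have dψ : ∀ x ∈ closure Ω, ContinuousAt ψ x := fun x hx => (cψ x (hV hx)).continuousAt
    have gφ : ∀ x ∈ closure Ω, ContinuousAt (gradient φ) x :=
      fun x hx => (aux_contDiffAt_grad (cφ x (hU hx))).continuousAt
    have gψ : ∀ x ∈ closure Ω, ContinuousAt (gradient ψ) x :=
      fun x hx => (aux_contDiffAt_grad (cψ x (hV hx))).continuousAt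
    have hXc : ∀ x, ContinuousAt (fun y : EuclideanSpace ℝ (Fin d) => y - c) x :=
      fun x => (continuous_id.sub continuous_const).continuousAt
    have iP : IntegrableOn (fun x => φ x * ψ x) Ω := hint _ fun x hx => (dφ x hx).mul (dψ x hx)
    have iφ : IntegrableOn (fun x => φ x ^ 2) Ω := hint _ fun x hx => (dφ x hx).pow 2
    have iψ : IntegrableOn (fun x => ψ x ^ 2) Ω := hint _ fun x hx => (dψ x hx).pow 2
    have iJ : IntegrableOn (fun x => φ x * ⟪x - c, gradient ψ x⟫ - ψ x * ⟪x - c, gradient φ x⟫) Ω :=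
      hint _ fun x hx => ((dφ x hx).mul ((hXc x).inner (gψ x hx))).sub
        ((dψ x hx).mul ((hXc x).inner (gφ x hx)))
    have iN : IntegrableOn (fun x => ⟪x - c, x - c⟫ * (φ x * ψ x)) Ω :=
      hint _ fun x hx => ((hXc x).inner (hXc x)).mul ((dφ x hx).mul (dψ x hx))
    -- the weighted Green identity
    have green : (∫ x in Ω, (φ x * ⟪x - c, gradient ψ x⟫ - ψ x * ⟪x - c, gradient φ x⟫))
        = (Eψ - Eφ) / 2 * ∫ x in Ω, ⟪x - c, x - c⟫ * (φ x * ψ x) := by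
      have h0 := hGG (fun y => (1 / 2 * ⟪y - c, y - c⟫ * φ y) • gradient ψ y
          + (-(1 / 2) * ⟪y - c, y - c⟫ * ψ y) • gradient φ y)
        ⟨U ∩ V, hUo.inter hVo, Set.subset_inter hU hV, fun x hx => by
          have hX : ContDiffAt ℝ 1 (fun y : EuclideanSpace ℝ (Fin d) => y - c) x :=
            contDiffAt_id.sub contDiffAt_const
          have hu1 : ContDiffAt ℝ 1 φ x := (cφ x hx.1).of_le (by norm_num)
          have hv1 : ContDiffAt ℝ 1 ψ x := (cψ x hx.2).of_le (by norm_num)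
          exact (((contDiffAt_const.mul (hX.inner ℝ hX)).mul hu1).smul
            (aux_contDiffAt_grad (cψ x hx.2)) |>.add
            (((contDiffAt_const.mul (hX.inner ℝ hX)).mul hv1).smul
            (aux_contDiffAt_grad (cφ x hx.1)))).contDiffWithinAt⟩
      obtain ⟨ΓD, -, γ, hD, hR⟩ := hbc
      rw [setIntegral_eq_zero_of_forall_eq_zero (μ := μH[(d:ℝ) - 1])] at h0
      swap
      · intro x hx
        simp only [inner_add_left, real_inner_smul_left]
        by_cases hxD : x ∈ ΓD
        · rw [(hD x hxD).1, (hD x hxD).2]; ring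
        · obtain ⟨r1, r2⟩ := hR x ⟨hx, hxD⟩
          rw [real_inner_comm (n x) (gradient ψ x), real_inner_comm (n x) (gradient φ x)]
          linear_combination (1 / 2 * ⟪x - c, x - c⟫) * (φ x * r2 - ψ x * r1)
      have hdiv : ∀ x ∈ Ω, divg (fun y => (1 / 2 * ⟪y - c, y - c⟫ * φ y) • gradient ψ y
          + (-(1 / 2) * ⟪y - c, y - c⟫ * ψ y) • gradient φ y) x
          = (φ x * ⟪x - c, gradient ψ x⟫ - ψ x * ⟪x - c, gradient φ x⟫)
            + (Eφ - Eψ) / 2 * (⟪x - c, x - c⟫ * (φ x * ψ x)) := by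
        intro x hx
        have hu := cφ x (hUΩ hx)
        have hv := cψ x (hVΩ hx)
        have hu1 : DifferentiableAt ℝ φ x := hu.differentiableAt (by norm_num)
        have hv1 : DifferentiableAt ℝ ψ x := hv.differentiableAt (by norm_num)
        have gu := (aux_contDiffAt_grad hu).differentiableAt (by norm_num)
        have gv := (aux_contDiffAt_grad hv).differentiableAt (by norm_num)
        have hX : HasFDerivAt (fun y : EuclideanSpace ℝ (Fin d) => y - c)
            (ContinuousLinearMap.id ℝ _) x := (hasFDerivAt_id x).sub_const c
        have k1 := ((hX.inner ℝ hX).const_mul (1 / 2 : ℝ)).mul hu1.hasFDerivAt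
        have k2 := ((hX.inner ℝ hX).const_mul (-(1 / 2) : ℝ)).mul hv1.hasFDerivAt
        have s1 := aux_divg_smul k1.differentiableAt gv
        have s2 := aux_divg_smul k2.differentiableAt gu
        rw [k1.fderiv, aux_divg_grad] at s1
        rw [k2.fderiv, aux_divg_grad] at s2
        have a1 := aux_divg_add (k1.differentiableAt.smul gv) (k2.differentiableAt.smul gu)
        refine (a1.trans (congrArg₂ (· + ·) s1 s2)).trans ?_
        have lu' : lap φ x = -(Eφ * φ x) := by linarith [hHφ x hx]
        have lv' : lap ψ x = -(Eψ * ψ x) := by linarith [hHψ x hx]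
        have y3 := real_inner_comm (gradient φ x) (gradient ψ x)
        have y5 := real_inner_comm (gradient φ x) (x - c)
        have y6 := real_inner_comm (gradient ψ x) (x - c)
        simp only [Pi.mul_apply, add_apply,
          smul_apply, ContinuousLinearMap.comp_apply, fderivInnerCLM_apply,
          ContinuousLinearMap.prod_apply, ContinuousLinearMap.id_apply, smul_eq_mul,
          aux_fderiv_inner_grad, lu', lv', y3, y5, y6]
        ring
      rw [setIntegral_congr_fun hΩo.measurableSet hdiv,
        integral_add iJ (iN.const_mul _), integral_const_mul] at h0
      linarith
    have hq : qformc d Ω n c φ ψ (Eφ + Eψ)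
        = (Eφ - Eψ) ^ 2 / 4 * ∫ x in Ω, ⟪x - c, x - c⟫ * (φ x * ψ x) := by
      rw [q_eq φ ψ _ (U ∩ V) (hUo.inter hVo) (Set.subset_inter hU hV)
        (fun x hx => cφ x hx.1) (fun x hx => cψ x hx.2)]
      have : ∀ x ∈ Ω, divg (auxF c φ ψ (Eφ + Eψ)) x = _ := fun x hx =>
        aux_divg_F (cφ x (hUΩ hx)) (cψ x (hVΩ hx)) (hHφ x hx) (hHψ x hx)
      rw [setIntegral_congr_fun hΩo.measurableSet this,
        integral_add (iP.const_mul _) (iJ.const_mul _), integral_const_mul, integral_const_mul,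
        horth, green]
      ring
    have hb : |∫ x in Ω, ⟪x - c, x - c⟫ * (φ x * ψ x)| ≤ Rc ^ 2 := by
      have h1 : |∫ x in Ω, ⟪x - c, x - c⟫ * (φ x * ψ x)|
          ≤ ∫ x in Ω, |⟪x - c, x - c⟫ * (φ x * ψ x)| := abs_integral_le_integral_abs
      have h2 : (∫ x in Ω, |⟪x - c, x - c⟫ * (φ x * ψ x)|)
          ≤ ∫ x in Ω, Rc ^ 2 / 2 * (φ x ^ 2 + ψ x ^ 2) := by
        refine setIntegral_mono_on iN.abs ((iφ.add iψ).const_mul _) hΩo.measurableSet ?_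
        intro x hx
        have hxr : ‖x - c‖ ≤ Rc := by
          have := hRc hx
          rwa [Metric.mem_closedBall, dist_eq_norm] at this
        have hsq : ‖x - c‖ ^ 2 ≤ Rc ^ 2 := pow_le_pow_left₀ (norm_nonneg _) hxr 2
        have hp : |φ x * ψ x| ≤ (φ x ^ 2 + ψ x ^ 2) / 2 := by
          rw [abs_le]
          constructor <;> nlinarith [sq_nonneg (φ x - ψ x), sq_nonneg (φ x + ψ x)]
        rw [real_inner_self_eq_norm_sq, abs_mul, abs_of_nonneg (sq_nonneg ‖x - c‖)]
        calc ‖x - c‖ ^ 2 * |φ x * ψ x| ≤ Rc ^ 2 * ((φ x ^ 2 + ψ x ^ 2) / 2) :=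
              mul_le_mul hsq hp (abs_nonneg _) (sq_nonneg _)
          _ = _ := by ring
      rw [integral_const_mul, integral_add iφ iψ, hφnorm, hψnorm] at h2
      linarith
    rw [hq, abs_mul, abs_of_nonneg (by positivity)]
    calc (Eφ - Eψ) ^ 2 / 4 * |∫ x in Ω, ⟪x - c, x - c⟫ * (φ x * ψ x)|
        ≤ (Eφ - Eψ) ^ 2 / 4 * Rc ^ 2 := mul_le_mul_of_nonneg_left hb (by positivity)
      _ = _ := by ring
end
end

section
/- Let d ≥ 2 be a natural number (regarded as a real number) and E_u, E_v ∈ ℝ with E_u ≠ E_v. Then the 8×8 real matrix ℳ(E_u,E_v,d) with rows (−E_u, 1, 0, 0, 0, 0, 0, 0), (−E_v, 1, 0, 0, 0, 0, 0, 0), (d, 0, 1, 1, 0, 0, 0, 0), (0, d, 0, 0, 1, 1, 0, 0), (0, 1, −E_v, 0, 1, 0, 0, 0), (0, 1, 0, −E_u, 0, 1, 0, 0), (0, 0, 2, 0, 0, 0, −E_u, 1), (0, 0, 0, 2, 0, 0, −E_v, 1) is invertible. -/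
open MeasureTheory
open scoped RealInnerProductSpace Classical

noncomputable section

/-- The coefficient matrix `ℳ(E_u, E_v, d)` expressing the divergences of eight bilinear
vector fields as linear combinations of eight bilinear scalar fields. -/
def coeffMatrix (Eu Ev dd : ℝ) : Matrix (Fin 8) (Fin 8) ℝ :=
  !![-Eu, 1, 0, 0, 0, 0, 0, 0;
     -Ev, 1, 0, 0, 0, 0, 0, 0;
     dd, 0, 1, 1, 0, 0, 0, 0;
     0, dd, 0, 0, 1, 1, 0, 0;
     0, 1, -Ev, 0, 1, 0, 0, 0;
     0, 1, 0, -Eu, 0, 1, 0, 0;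
     0, 0, 2, 0, 0, 0, -Eu, 1;
     0, 0, 0, 2, 0, 0, -Ev, 1]

theorem coeffMatrix_invertible_of_ne
    (d : ℕ) (hd : 2 ≤ d) (Eu Ev : ℝ) (hne : Eu ≠ Ev) :
    IsUnit (coeffMatrix Eu Ev (d : ℝ)) := by
  rw [← Matrix.mulVec_injective_iff_isUnit]
  intro a b hab
  have hz : (coeffMatrix Eu Ev (d : ℝ)).mulVec (a - b) = 0 := by
    rw [Matrix.mulVec_sub, sub_eq_zero]
    exact hab
  rw [← sub_eq_zero]
  generalize a - b = x at hz
  have hE : Eu - Ev ≠ 0 := sub_ne_zero.mpr hne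
  have h0 := congrFun hz 0
  have h1 := congrFun hz 1
  have h2 := congrFun hz 2
  have h3 := congrFun hz 3
  have h4 := congrFun hz 4
  have h5 := congrFun hz 5
  have h6 := congrFun hz 6
  have h7 := congrFun hz 7
  simp [coeffMatrix, Matrix.mulVec, dotProduct, Fin.sum_univ_eight]
    at h0 h1 h2 h3 h4 h5 h6 h7
  have x0 : x 0 = 0 := (mul_eq_zero.mp (show (Eu - Ev) * x 0 = 0 by linarith)).resolve_left hE
  have x1 : x 1 = 0 := by rw [x0] at h0; linarith
  simp only [x0, x1, mul_zero, zero_add] at h2 h3 h4 h5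
  have e3 : x 3 = - x 2 := by linarith
  rw [e3] at h5 h7
  have x2 : x 2 = 0 := (mul_eq_zero.mp (show (Eu - Ev) * x 2 = 0 by linarith)).resolve_left hE
  rw [x2] at h4 h5 h6 h7 e3
  have x4 : x 4 = 0 := by linarith
  have x5 : x 5 = 0 := by linarith
  have x6 : x 6 = 0 := (mul_eq_zero.mp (show (Eu - Ev) * x 6 = 0 by linarith)).resolve_left hE
  have x7 : x 7 = 0 := by rw [x6] at h6; linarith
  ext i
  fin_cases i <;> simp [*]
end
end
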